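/- An indecomposable object Q of an abelian length category 𝒜 is injective if and only if there exists a length function ℓ on 𝒜 such that ℓ*(X) ≤ ℓ*(Q) for every indecomposable object X, where ℓ* denotes the Gabriel-Roiter measure with respect to ℓ. -/

import Mathlib

open CategoryTheory CategoryTheory.Limits

/-- The lexicographic order on finite chains (here: finite subsets of a linear order):
`X ≤ Y` iff `min (Y \ X) ≤ min (X \ Y)`, with the convention `max ∅ < x < min ∅`. -/
def lexLE {T : Type*} [PartialOrder T] [DecidableEq T] (X Y : Finset T) : Prop :=
  X \ Y = ∅ ∨ ∃ b ∈ Y \ X, ∀ a ∈ X \ Y, b ≤ a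

def lexLT {T : Type*} [PartialOrder T] [DecidableEq T] (X Y : Finset T) : Prop :=
  lexLE X Y ∧ ¬ lexLE Y X

universe v u

variable (C : Type u) [Category.{v} C] [Abelian C]

/-- The abelian category is a length category: every object is artinian and noetherian,
i.e. its subobject lattice satisfies both chain conditions (equivalently, every object
has a finite composition series). -/
def IsLengthCategory : Prop :=
  ∀ X : C, WellFoundedLT (Subobject X) ∧ WellFoundedGT (Subobject X)

variable {C}

/-- `X` is (isomorphic to) a subobject of `Y`. -/
def SubOf (X Y : C) : Prop := ∃ f : X ⟶ Y, Mono f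

/-- `X` is a proper subobject of `Y` (strict order on the poset of isoclasses of
indecomposables ordered by the subobject relation). -/
def StrictSubOf (X Y : C) : Prop := SubOf X Y ∧ ¬ SubOf Y X

/-- `X` is indecomposable: nonzero, and any biproduct decomposition has a zero summand. -/
def Indec (X : C) : Prop :=
  ¬ IsZero X ∧ ∀ A B : C, Nonempty (X ≅ A ⊞ B) → IsZero A ∨ IsZero B

/-- A length function on an abelian length category: real-valued, nonnegative, zero
exactly on zero objects, and additive on short exact sequences. -/
def IsLengthFunctionCat (l : C → ℝ) : Prop :=
  (∀ X : C, 0 ≤ l X) ∧ (∀ X : C, l X = 0 ↔ IsZero X) ∧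
  (∀ Sc : ShortComplex C, Sc.ShortExact → l Sc.X₂ = l Sc.X₁ + l Sc.X₃)

/-- `μ` is the Gabriel-Roiter measure `ℓ*` with respect to `l`: for each
indecomposable `X`, `μ X ∈ Ch(ℝ)` is the lexicographic maximum of the sets
`{l X₁, …, l Xₙ}` over all chains `X₁ ⊂ X₂ ⊂ ⋯ ⊂ Xₙ = X` of indecomposable
subobjects of `X`. -/
def IsGRMeasure (l : C → ℝ) (μ : C → Finset ℝ) : Prop :=
  ∀ X : C, Indec X →
    (∃ (n : ℕ) (Z : Fin (n + 1) → C), (∀ i, Indec (Z i)) ∧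
      (∀ i j : Fin (n + 1), i < j → StrictSubOf (Z i) (Z j)) ∧ Z (Fin.last n) = X ∧
      μ X = Finset.univ.image fun i => l (Z i)) ∧
    (∀ (n : ℕ) (Z : Fin (n + 1) → C), (∀ i, Indec (Z i)) →
      (∀ i j : Fin (n + 1), i < j → StrictSubOf (Z i) (Z j)) → Z (Fin.last n) = X →
      lexLE (Finset.univ.image fun i => l (Z i)) (μ X))

/-- Elementary form of short exactness of `A ⟶ B ⟶ T`. -/
structure SES {A B T : C} (f : A ⟶ B) (g : B ⟶ T) : Prop where
  mono : Mono f
  epi : Epi g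
  w : f ≫ g = 0
  lift : ∀ {W : C} (k : W ⟶ B), k ≫ g = 0 → ∃ l, l ≫ f = k

namespace SES

lemma shortExact {A B T : C} {f : A ⟶ B} {g : B ⟶ T} (h : SES f g) :
    (ShortComplex.mk f g h.w).ShortExact := by
  have := h.mono
  have := h.epi
  refine ShortComplex.ShortExact.mk' (ShortComplex.exact_of_f_is_kernel _ ?_) h.mono h.epi
  exact KernelFork.IsLimit.ofι' f h.w fun k hk =>
    ⟨(h.lift k hk).choose, (h.lift k hk).choose_spec⟩

lemma of_shortExact (S : ShortComplex C) (h : S.ShortExact) : SES S.f S.g := by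
  have := h.mono_f
  exact ⟨h.mono_f, h.epi_g, S.zero, fun k hk => ⟨h.exact.lift k hk, h.exact.lift_f k hk⟩⟩

lemma of_epi {B T : C} (g : B ⟶ T) [Epi g] : SES (kernel.ι g) g :=
  ⟨inferInstance, inferInstance, kernel.condition g,
    fun k hk => ⟨kernel.lift g k hk, kernel.lift_ι g k hk⟩⟩

lemma of_mono {A B : C} (f : A ⟶ B) [Mono f] : SES f (cokernel.π f) :=
  ⟨inferInstance, inferInstance, cokernel.condition f,
    fun k hk => ⟨Abelian.monoLift f k hk, Abelian.monoLift_comp f k hk⟩⟩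

lemma of_iso_middle {A B T B' : C} {f : A ⟶ B} {g : B ⟶ T} (h : SES f g) (e : B ≅ B') :
    SES (f ≫ e.hom) (e.inv ≫ g) := by
  have := h.mono
  have := h.epi
  refine ⟨inferInstance, inferInstance, by simp [h.w], fun k hk => ?_⟩
  obtain ⟨l, hl⟩ := h.lift (k ≫ e.inv) (by simpa using hk)
  exact ⟨l, by rw [← Category.assoc, hl]; simp⟩

/-- The diagonal of the square of two subobjects `A`, `A'` of `B`. -/
lemma inter {A B A' T' : C} {f : A ⟶ B} {f' : A' ⟶ B} {g' : B ⟶ T'}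
    (h' : SES f' g') (e : Epi (f ≫ g')) :
    SES (pullback.fst f f') (f ≫ g') := by
  have := h'.mono
  refine ⟨inferInstance, e, ?_, fun k hk => ?_⟩
  · rw [← Category.assoc, pullback.condition, Category.assoc, h'.w, comp_zero]
  · obtain ⟨l, hl⟩ := h'.lift (k ≫ f) (by simpa using hk)
    exact ⟨pullback.lift k l hl.symm, pullback.lift_fst _ _ _⟩

lemma inter' {A B T A' : C} {f : A ⟶ B} {g : B ⟶ T} {f' : A' ⟶ B}
    (h : SES f g) (e : Epi (f' ≫ g)) :
    SES (pullback.snd f f') (f' ≫ g) := by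
  have := h.mono
  refine ⟨inferInstance, e, ?_, fun k hk => ?_⟩
  · rw [← Category.assoc, ← pullback.condition, Category.assoc, h.w, comp_zero]
  · obtain ⟨l, hl⟩ := h.lift (k ≫ f') (by simpa using hk)
    exact ⟨pullback.lift l k hl, pullback.lift_snd _ _ _⟩

/-- A map killing the subobject factors through the quotient. -/
lemma desc {A B T W : C} {f : A ⟶ B} {g : B ⟶ T} (h : SES f g) (k : B ⟶ W) (hk : f ≫ k = 0) :
    ∃ l, g ≫ l = k := by
  have := h.epi
  exact ⟨h.shortExact.exact.desc k hk, h.shortExact.exact.g_desc k hk⟩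

end SES

/-- `B` has a finite filtration with simple subquotients of total weight `r`. -/
inductive HasLen (w : C → ℕ) : C → ℕ → Prop
  | zero {B : C} : IsZero B → HasLen w B 0
  | step {A B T : C} {f : A ⟶ B} {g : B ⟶ T} {r : ℕ} :
      SES f g → Simple T → HasLen w A r → HasLen w B (r + w T)

lemma HasLen.iso {w : C → ℕ} {X Y : C} {r : ℕ} (h : HasLen w X r) (e : X ≅ Y) :
    HasLen w Y r := by
  cases h with
  | zero h => exact .zero (h.of_iso e.symm)
  | step h hT hA => exact .step (h.of_iso_middle e) hT hA

lemma HasLen.add {w : C → ℕ} {A B T : C} {r s : ℕ} (hT : HasLen w T s) (hA : HasLen w A r)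
    {f : A ⟶ B} {g : B ⟶ T} (h : SES f g) : HasLen w B (r + s) := by
  induction hT generalizing B with
  | zero hz =>
    have := h.mono
    obtain ⟨l, hl⟩ := h.lift (𝟙 B) (hz.eq_of_tgt _ _)
    have : IsIso f := ⟨l, by rw [← cancel_mono f, Category.assoc, hl]; simp, hl⟩
    exact hA.iso (asIso f)
  | @step T' T S f' g' s' h' hS _ ih =>
    have := h.mono
    have := h.epi
    have := h'.mono
    have := h'.epi
    have h1 : SES (pullback.fst g f') (g ≫ g') := by
      refine ⟨inferInstance, inferInstance, ?_, fun k hk => ?_⟩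
      · rw [← Category.assoc, pullback.condition, Category.assoc, h'.w, comp_zero]
      · obtain ⟨l, hl⟩ := h'.lift (k ≫ g) (by simpa using hk)
        exact ⟨pullback.lift k l hl.symm, pullback.lift_fst _ _ _⟩
    have h2 : SES (pullback.lift f (0 : A ⟶ T') (by simp [h.w]) : A ⟶ pullback g f')
        (pullback.snd g f') := by
      refine ⟨mono_of_mono_fac (pullback.lift_fst _ _ _), inferInstance,
        pullback.lift_snd _ _ _, fun k hk => ?_⟩
      obtain ⟨l, hl⟩ := h.lift (k ≫ pullback.fst g f')
        (by rw [Category.assoc, pullback.condition, ← Category.assoc, hk, zero_comp])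
      exact ⟨l, by apply pullback.hom_ext <;> simp [pullback.lift_fst, pullback.lift_snd, hl, hk]⟩
    rw [← add_assoc]
    exact .step h1 hS (ih h2)

/-- `X` embeds properly in `Y`. -/
def ProperSub {D : Type u} [Category.{v} D] (X Y : D) : Prop := ∃ f : X ⟶ Y, Mono f ∧ ¬ IsIso f

lemma wellFounded_properSub {D : Type u} [Category.{v} D] (hC : IsLengthCategory D) :
    WellFounded (ProperSub (D := D)) := by
  refine ⟨fun X => ?_⟩
  have key : ∀ S : Subobject X, ∀ B : D, Nonempty (B ≅ (S : D)) → Acc ProperSub B := by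
    have := (hC X).1
    intro S
    induction S using WellFoundedLT.induction with
    | ind S ih =>
      rintro B ⟨e⟩
      refine ⟨_, ?_⟩
      rintro B' ⟨f, hf, hn⟩
      refine ih (Subobject.mk (f ≫ e.hom ≫ S.arrow)) ?_ B' ⟨(Subobject.underlyingIso _).symm⟩
      refine lt_of_le_of_ne (Subobject.mk_le_of_comm (f ≫ e.hom) (by simp)) fun h => hn ?_
      have hle : Subobject.mk S.arrow ≤ Subobject.mk (f ≫ e.hom ≫ S.arrow) := by simp [h]
      have : Subobject.ofMkLEMk _ _ hle ≫ (f ≫ e.hom) = 𝟙 _ := by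
        rw [← cancel_mono S.arrow]
        simp
      have : IsSplitEpi (f ≫ e.hom) := ⟨⟨⟨_, this⟩⟩⟩
      have h3 : IsIso (f ≫ e.hom) := isIso_of_mono_of_isSplitEpi _
      exact IsIso.of_isIso_comp_right f e.hom
  exact key ⊤ X ⟨(asIso (⊤ : Subobject X).arrow).symm⟩

lemma exists_simple_quotient (hC : IsLengthCategory C) (X : C) (hX : ¬ IsZero X) :
    ∃ (A T : C) (f : A ⟶ X) (g : X ⟶ T), SES f g ∧ Simple T := by
  have := (hC X).2
  have hbt : (⊥ : Subobject X) ≠ ⊤ := fun h => hX (by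
    have h1 : IsIso (⊥ : Subobject X).arrow := (Subobject.isIso_arrow_iff_eq_top _).2 h
    exact (isZero_zero C).of_iso ((asIso (⊥ : Subobject X).arrow).symm ≪≫ Subobject.botCoeIsoZero))
  obtain ⟨M, hM, hmax⟩ := WellFounded.has_min (wellFounded_gt (α := Subobject X)) {S | S ≠ ⊤}
    ⟨⊥, hbt⟩
  refine ⟨_, _, M.arrow, cokernel.π M.arrow, SES.of_mono _, ⟨fun {Z} k hk => ⟨?_, fun h0 => ?_⟩⟩⟩
  · rintro hi rfl
    have hz : 𝟙 (cokernel M.arrow) = 0 := by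
      rw [← IsIso.inv_hom_id (0 : Z ⟶ cokernel M.arrow)]; simp
    refine hM ((Subobject.isIso_arrow_iff_eq_top _).1 ?_)
    have : Epi M.arrow := Preadditive.epi_of_cokernel_zero (by
      rw [← Category.comp_id (cokernel.π M.arrow), hz, comp_zero])
    exact isIso_of_mono_of_epi _
  · have hle : M ≤ Subobject.mk (pullback.fst (cokernel.π M.arrow) k) :=
      Subobject.le_mk_of_comm (pullback.lift M.arrow 0 (by simp))
        (pullback.lift_fst _ _ _)
    have htop : Subobject.mk (pullback.fst (cokernel.π M.arrow) k) = ⊤ := by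
      by_contra hne
      refine hmax _ hne (lt_of_le_of_ne hle fun he => h0 ?_)
      have h1 : pullback.fst (cokernel.π M.arrow) k ≫ cokernel.π M.arrow = 0 := by
        have hle' : Subobject.mk (pullback.fst (cokernel.π M.arrow) k) ≤ M := he.ge
        rw [← Subobject.ofMkLE_arrow hle', Category.assoc, cokernel.condition, comp_zero]
      rw [pullback.condition] at h1
      exact (cancel_epi (pullback.snd (cokernel.π M.arrow) k)).1 (by rw [h1, comp_zero])
    have : IsIso (pullback.fst (cokernel.π M.arrow) k) :=
      (Subobject.isIso_iff_mk_eq_top _).2 htop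
    have : Epi (pullback.snd (cokernel.π M.arrow) k ≫ k) := by
      rw [← pullback.condition]; infer_instance
    have : Epi k := epi_of_epi (pullback.snd (cokernel.π M.arrow) k) k
    exact isIso_of_mono_of_epi _

lemma SES.properSub {A B T : C} {f : A ⟶ B} {g : B ⟶ T} (h : SES f g) (hT : ¬ IsZero T) :
    ProperSub A B := by
  refine ⟨f, h.mono, fun hi => hT ?_⟩
  have := h.epi
  rw [IsZero.iff_id_eq_zero, ← cancel_epi g, ← cancel_epi f, ← Category.assoc, h.w]
  simp

lemma exists_hasLen (hC : IsLengthCategory C) (w : C → ℕ) (X : C) : ∃ r, HasLen w X r := by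
  induction X using (wellFounded_properSub hC).induction with
  | h X ih =>
    by_cases hX : IsZero X
    · exact ⟨0, .zero hX⟩
    · obtain ⟨A, T, f, g, h, hT⟩ := exists_simple_quotient hC X hX
      obtain ⟨r, hr⟩ := ih A (h.properSub (Simple.not_isZero T))
      exact ⟨_, .step h hT hr⟩

lemma SES.not_isZero_middle {A B T : C} {f : A ⟶ B} {g : B ⟶ T} (h : SES f g) (hT : Simple T) :
    ¬ IsZero B := fun hB => by
  have := h.epi
  exact Simple.not_isZero T (IsZero.of_epi g hB)

lemma SES.exists_iso_of_comp_eq_zero {A B T A' T' : C} {f : A ⟶ B} {g : B ⟶ T} {f' : A' ⟶ B}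
    {g' : B ⟶ T'} (h : SES f g) (h' : SES f' g') (hT : Simple T) (hT' : Simple T')
    (h0 : f ≫ g' = 0) : Nonempty (A ≅ A') ∧ Nonempty (T ≅ T') := by
  have := h.mono
  have := h.epi
  have := h'.mono
  have := h'.epi
  obtain ⟨t, ht⟩ := h.desc g' h0
  have : Epi t := epi_of_epi_fac ht
  have htn : t ≠ 0 := by
    rintro rfl
    refine Simple.not_isZero T' (IsZero.of_epi_eq_zero g' ?_)
    rw [← ht, comp_zero]
  have : IsIso t := isIso_of_epi_of_nonzero htn
  obtain ⟨l, hl⟩ := h'.lift f h0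
  obtain ⟨m, hm⟩ := h.lift f' (by rw [← cancel_mono t, Category.assoc, ht, h'.w, zero_comp])
  refine ⟨⟨⟨l, m, ?_, ?_⟩⟩, ⟨asIso t⟩⟩
  · rw [← cancel_mono f, Category.assoc, hm, hl, Category.id_comp]
  · rw [← cancel_mono f', Category.assoc, hl, hm, Category.id_comp]

lemma HasLen.unique (hC : IsLengthCategory C) {w : C → ℕ}
    (hw : ∀ T T' : C, Nonempty (T ≅ T') → w T = w T') (X : C) :
    ∀ {r s : ℕ}, HasLen w X r → HasLen w X s → r = s := by
  induction X using (wellFounded_properSub hC).induction with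
  | h X ih =>
    intro r s hr hs
    cases hr with
    | zero hz =>
      cases hs with
      | zero => rfl
      | step h hT _ => exact absurd hz (h.not_isZero_middle hT)
    | @step A _ T f g r h hT hA =>
      cases hs with
      | zero hz => exact absurd hz (h.not_isZero_middle hT)
      | @step A' _ T' f' g' s h' hT' hA' =>
        have pA := h.properSub (Simple.not_isZero T)
        have pA' := h'.properSub (Simple.not_isZero T')
        by_cases h0 : f ≫ g' = 0
        · obtain ⟨⟨e⟩, et⟩ := h.exists_iso_of_comp_eq_zero h' hT hT' h0
          rw [hw _ _ et, ih A pA hA (hA'.iso e.symm)]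
        by_cases h1 : f' ≫ g = 0
        · obtain ⟨⟨e⟩, et⟩ := h'.exists_iso_of_comp_eq_zero h hT' hT h1
          rw [hw _ _ et, ih A pA hA (hA'.iso e)]
        have e0 : Epi (f ≫ g') := epi_of_nonzero_to_simple h0
        have e1 : Epi (f' ≫ g) := epi_of_nonzero_to_simple h1
        obtain ⟨d, hd⟩ := exists_hasLen hC w (pullback f f')
        have a1 := ih A pA hA (.step (h'.inter e0) hT' hd)
        have a2 := ih A' pA' hA' (.step (h.inter' e1) hT hd)
        omega

/-- The total weight of the composition factors of `X`. -/
noncomputable def weightLen (hC : IsLengthCategory C) (w : C → ℕ) (X : C) : ℕ :=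
  (exists_hasLen hC w X).choose

lemma hasLen_weightLen (hC : IsLengthCategory C) (w : C → ℕ) (X : C) :
    HasLen w X (weightLen hC w X) :=
  (exists_hasLen hC w X).choose_spec

lemma isLengthFunctionCat_weightLen (hC : IsLengthCategory C) {w : C → ℕ}
    (hw : ∀ T T' : C, Nonempty (T ≅ T') → w T = w T') (hpos : ∀ T, 0 < w T) :
    IsLengthFunctionCat fun X : C => (weightLen hC w X : ℝ) := by
  refine ⟨fun X => Nat.cast_nonneg _, fun X => ?_, fun S hS => ?_⟩
  · have h := hasLen_weightLen hC w X
    simp only [Nat.cast_eq_zero]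
    constructor
    · intro h0
      rw [h0] at h
      generalize hr : 0 = r at h
      cases h with
      | zero hz => exact hz
      | @step A _ T _ _ r => have := hpos T; omega
    · exact fun hz => HasLen.unique hC hw X h (.zero hz)
  · have h := HasLen.unique hC hw _ (hasLen_weightLen hC w S.X₂)
      ((hasLen_weightLen hC w S.X₃).add (hasLen_weightLen hC w S.X₁) (SES.of_shortExact S hS))
    simp only [h, Nat.cast_add]

section LexOrder

variable {T : Type*} [LinearOrder T] {X Y Z : Finset T}

lemma lexLE_iff : lexLE X Y ↔ X = Y ∨ ∃ b ∈ Y, b ∉ X ∧ ∀ a < b, (a ∈ X ↔ a ∈ Y) := by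
  constructor
  · intro h
    by_cases hne : (Y \ X).Nonempty
    · right
      have hm := Finset.min'_mem _ hne
      refine ⟨(Y \ X).min' hne, (Finset.mem_sdiff.1 hm).1, (Finset.mem_sdiff.1 hm).2,
        fun a ha => ⟨fun hX => ?_, fun hY => ?_⟩⟩
      · by_contra hY
        rcases h with h | ⟨b, hb, h⟩
        · exact Finset.notMem_empty a (h ▸ Finset.mem_sdiff.2 ⟨hX, hY⟩)
        · exact absurd ((Finset.min'_le _ b hb).trans (h a (Finset.mem_sdiff.2 ⟨hX, hY⟩)))
            (not_le.2 ha)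
      · by_contra hX
        exact absurd (Finset.min'_le _ a (Finset.mem_sdiff.2 ⟨hY, hX⟩)) (not_le.2 ha)
    · left
      rw [Finset.not_nonempty_iff_eq_empty] at hne
      rcases h with h | ⟨b, hb, -⟩
      · exact (Finset.sdiff_eq_empty_iff_subset.1 h).antisymm
          (Finset.sdiff_eq_empty_iff_subset.1 hne)
      · simp [hne] at hb
  · rintro (rfl | ⟨b, hY, hX, h⟩)
    · exact .inl (by simp)
    · refine .inr ⟨b, Finset.mem_sdiff.2 ⟨hY, hX⟩, fun a ha => not_lt.1 fun hab => ?_⟩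
      rw [Finset.mem_sdiff] at ha
      exact ha.2 ((h a hab).1 ha.1)

lemma lexLT_iff : lexLT X Y ↔ ∃ b ∈ Y, b ∉ X ∧ ∀ a < b, (a ∈ X ↔ a ∈ Y) := by
  rw [lexLT, lexLE_iff, lexLE_iff]
  constructor
  · rintro ⟨rfl | h, h'⟩
    · simp at h'
    · exact h
  · intro h
    refine ⟨.inr h, ?_⟩
    obtain ⟨b, hY, hX, h⟩ := h
    rintro (rfl | ⟨c, hX', hY', h'⟩)
    · exact hX hY
    · rcases lt_trichotomy b c with hbc | rfl | hbc
      · exact hX ((h' b hbc).1 hY)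
      · exact hX hX'
      · exact hY' ((h c hbc).1 hX')

lemma lexLE_iff_eq_or_lexLT : lexLE X Y ↔ X = Y ∨ lexLT X Y := by
  rw [lexLT_iff, lexLE_iff]

lemma lexLE_refl (X : Finset T) : lexLE X X := .inl (by simp)

lemma lexLT.trans (h : lexLT X Y) (h' : lexLT Y Z) : lexLT X Z := by
  rw [lexLT_iff] at *
  obtain ⟨b, hbY, hbX, hb⟩ := h
  obtain ⟨c, hcZ, hcY, hc⟩ := h'
  rcases lt_trichotomy b c with hbc | rfl | hbc
  · exact ⟨b, (hc b hbc).1 hbY, hbX, fun a ha => (hb a ha).trans (hc a (ha.trans hbc))⟩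
  · exact absurd hbY hcY
  · exact ⟨c, hcZ, fun hcX => hcY ((hb c hbc).1 hcX),
      fun a ha => (hb a (ha.trans hbc)).trans (hc a ha)⟩

lemma lexLT.trans_le (h : lexLT X Y) (h' : lexLE Y Z) : lexLT X Z := by
  rcases lexLE_iff_eq_or_lexLT.1 h' with rfl | h'
  exacts [h, h.trans h']

lemma lexLE_trans (h : lexLE X Y) (h' : lexLE Y Z) : lexLE X Z := by
  rcases lexLE_iff_eq_or_lexLT.1 h with rfl | h
  exacts [h', (h.trans_le h').1]

lemma lexLE_antisymm (h : lexLE X Y) (h' : lexLE Y X) : X = Y := by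
  rcases lexLE_iff_eq_or_lexLT.1 h with rfl | h
  exacts [rfl, absurd h' h.2]

lemma lexLE_total (X Y : Finset T) : lexLE X Y ∨ lexLE Y X := by
  by_cases hne : (symmDiff X Y).Nonempty
  · have hm := Finset.min'_mem _ hne
    have hlt : ∀ a < (symmDiff X Y).min' hne, (a ∈ X ↔ a ∈ Y) := fun a ha => by
      by_contra hcon
      refine absurd (Finset.min'_le _ a ?_) (not_le.2 ha)
      rw [Finset.mem_symmDiff]
      tauto
    rw [lexLE_iff, lexLE_iff]
    rcases Finset.mem_symmDiff.1 hm with ⟨h1, h2⟩ | ⟨h1, h2⟩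
    · exact .inr (.inr ⟨_, h1, h2, fun a ha => (hlt a ha).symm⟩)
    · exact .inl (.inr ⟨_, h1, h2, hlt⟩)
  · rw [Finset.not_nonempty_iff_eq_empty] at hne
    have : X = Y := symmDiff_eq_bot.1 hne
    exact .inl (this ▸ lexLE_refl X)

lemma lexLT_insert_of_lt {x : T} (h : ∀ a ∈ X, a < x) : lexLT X (insert x X) := by
  rw [lexLT_iff]
  exact ⟨x, by simp, fun hx => lt_irrefl _ (h x hx), fun a ha => by simp [ha.ne]⟩

lemma lexLT_empty (hX : X.Nonempty) : lexLT ∅ X :=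
  ⟨.inl (by simp), fun h => by simp [lexLE, hX.ne_empty] at h⟩

lemma lexLE_insert_insert {x : T} (h : lexLE X Y) (hY : ∀ a ∈ Y, a < x) :
    lexLE (insert x X) (insert x Y) := by
  rw [lexLE_iff] at *
  rcases h with rfl | ⟨b, hbY, hbX, hb⟩
  · exact .inl rfl
  · have hbx := hY b hbY
    exact .inr ⟨b, by simp [hbY], by simp [hbX, hbx.ne],
      fun a ha => by simp [(ha.trans hbx).ne, hb a ha]⟩

lemma lexLT.insert_left {x : T} (h : lexLT X Y) (hY : ∀ a ∈ Y, a < x) :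
    lexLT (insert x X) Y := by
  rw [lexLT_iff] at *
  obtain ⟨b, hbY, hbX, hb⟩ := h
  have hbx := hY b hbY
  exact ⟨b, hbY, by simp [hbX, hbx.ne], fun a ha => by simp [(ha.trans hbx).ne, hb a ha]⟩

lemma exists_lexLE_max {S : Set (Finset T)} (hS : S.Finite) (hne : S.Nonempty) :
    ∃ s ∈ S, ∀ t ∈ S, lexLE t s := by
  induction S, hS using Set.Finite.induction_on with
  | empty => simp at hne
  | @insert a S _ _ ih =>
    rcases S.eq_empty_or_nonempty with rfl | hS
    · exact ⟨a, by simp, by simp [lexLE_refl]⟩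
    · obtain ⟨s, hs, h⟩ := ih hS
      rcases lexLE_total a s with has | hsa
      · refine ⟨s, by simp [hs], ?_⟩
        rintro t (rfl | ht)
        exacts [has, h t ht]
      · refine ⟨a, by simp, ?_⟩
        rintro t (rfl | ht)
        exacts [lexLE_refl _, lexLE_trans (h t ht) hsa]

end LexOrder

namespace IsLengthFunctionCat

variable {l : C → ℝ} (hl : IsLengthFunctionCat l)
include hl

lemma eq_add {A B T : C} {f : A ⟶ B} {g : B ⟶ T} (h : SES f g) : l B = l A + l T :=
  hl.2.2 _ h.shortExact

lemma le_of_mono {X Y : C} (f : X ⟶ Y) [Mono f] : l X ≤ l Y := by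
  have := hl.eq_add (SES.of_mono f)
  have := hl.1 (cokernel f)
  linarith

lemma eq_of_iso {X Y : C} (e : X ≅ Y) : l X = l Y :=
  (hl.le_of_mono e.hom).antisymm (hl.le_of_mono e.inv)

lemma isIso_of_mono {X Y : C} (f : X ⟶ Y) [Mono f] (h : l Y ≤ l X) : IsIso f := by
  have h1 := hl.eq_add (SES.of_mono f)
  have h2 := hl.1 (cokernel f)
  have : IsZero (cokernel f) := (hl.2.1 _).1 (by linarith)
  have : Epi f := Preadditive.epi_of_cokernel_zero (this.eq_of_tgt _ _)
  exact isIso_of_mono_of_epi f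

lemma isIso_of_epi {X Y : C} (f : X ⟶ Y) [Epi f] (h : l X ≤ l Y) : IsIso f := by
  have h1 := hl.eq_add (SES.of_epi f)
  have h2 := hl.1 (kernel f)
  have : IsZero (kernel f) := (hl.2.1 _).1 (by linarith)
  have : Mono f := Preadditive.mono_of_kernel_zero (this.eq_of_src _ _)
  exact isIso_of_mono_of_epi f

lemma strictSubOf_iff {X Y : C} : StrictSubOf X Y ↔ SubOf X Y ∧ l X < l Y := by
  refine and_congr_right fun ⟨f, hf⟩ => ⟨fun h => ?_, fun h ⟨g, hg⟩ => ?_⟩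
  · by_contra hle
    have := hl.isIso_of_mono f (not_lt.1 hle)
    exact h ⟨inv f, inferInstance⟩
  · exact absurd (hl.le_of_mono g) (not_le.2 h)

lemma strictSubOf_of_mono {X Y : C} (f : X ⟶ Y) [Mono f] (h : ¬ IsIso f) : StrictSubOf X Y :=
  hl.strictSubOf_iff.2 ⟨⟨f, inferInstance⟩, lt_of_not_ge fun h' => h (hl.isIso_of_mono f h')⟩

lemma strictSubOf_trans {X Y Z : C} (h : StrictSubOf X Y) (h' : StrictSubOf Y Z) :
    StrictSubOf X Z := by
  rw [hl.strictSubOf_iff] at *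
  obtain ⟨⟨f, hf⟩, hXY⟩ := h
  obtain ⟨⟨g, hg⟩, hYZ⟩ := h'
  exact ⟨⟨f ≫ g, inferInstance⟩, hXY.trans hYZ⟩

end IsLengthFunctionCat

lemma Indec.iso {X Y : C} (h : Indec X) (e : X ≅ Y) : Indec Y :=
  ⟨fun hY => h.1 (hY.of_iso e), fun A B ⟨d⟩ => h.2 A B ⟨e ≪≫ d⟩⟩

/-- `s` is the set of lengths along a chain of indecomposables ending at the given object. -/
inductive GRChain (l : C → ℝ) : C → Finset ℝ → Prop
  | base {X : C} : Indec X → GRChain l X {l X}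
  | step {Y X : C} {s : Finset ℝ} : GRChain l Y s → Indec X → StrictSubOf Y X →
      GRChain l X (insert (l X) s)

namespace GRChain

variable {l : C → ℝ} {X Y : C} {s : Finset ℝ}

lemma indec (h : GRChain l X s) : Indec X := by
  cases h <;> assumption

lemma mem (h : GRChain l X s) : l X ∈ s := by
  cases h <;> simp

lemma le (hl : IsLengthFunctionCat l) (h : GRChain l X s) : ∀ a ∈ s, a ≤ l X := by
  induction h with
  | base => simp
  | step _ _ hYX ih =>
    have := (hl.strictSubOf_iff.1 hYX).2
    intro a ha
    rcases Finset.mem_insert.1 ha with rfl | ha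
    exacts [le_rfl, (ih a ha).trans this.le]

lemma lt (hl : IsLengthFunctionCat l) (h : GRChain l X s) (hXY : StrictSubOf X Y) :
    ∀ a ∈ s, a < l Y := fun a ha => (h.le hl a ha).trans_lt (hl.strictSubOf_iff.1 hXY).2

lemma iso (hl : IsLengthFunctionCat l) (h : GRChain l X s) (e : X ≅ Y) : GRChain l Y s := by
  cases h with
  | base hX => exact hl.eq_of_iso e ▸ base (hX.iso e)
  | step hZ hX hZX =>
    rw [hl.eq_of_iso e]
    obtain ⟨⟨f, hf⟩, hlt⟩ := hl.strictSubOf_iff.1 hZX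
    exact hZ.step (hX.iso e)
      (hl.strictSubOf_iff.2 ⟨⟨f ≫ e.hom, inferInstance⟩, hl.eq_of_iso e ▸ hlt⟩)

lemma of_fin (n : ℕ) (Z : Fin (n + 1) → C) (hZ : ∀ i, Indec (Z i))
    (hlt : ∀ i j : Fin (n + 1), i < j → StrictSubOf (Z i) (Z j)) :
    GRChain l (Z (Fin.last n)) (Finset.univ.image fun i => l (Z i)) := by
  induction n with
  | zero => simpa using base (hZ 0)
  | succ n ih =>
    have := (ih (fun i => Z i.castSucc) (fun i => hZ _) fun i j h => hlt _ _ h).step (hZ (Fin.last _))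
      (hlt _ _ (Fin.castSucc_lt_last _))
    convert this using 1
    ext a
    simp [Fin.exists_fin_succ', or_comm, eq_comm]

lemma exists_fin (hl : IsLengthFunctionCat l) (h : GRChain l X s) :
    ∃ (n : ℕ) (Z : Fin (n + 1) → C), (∀ i, Indec (Z i)) ∧
      (∀ i j : Fin (n + 1), i < j → StrictSubOf (Z i) (Z j)) ∧ Z (Fin.last n) = X ∧
      s = Finset.univ.image fun i => l (Z i) := by
  induction h with
  | @base X hX =>
    exact ⟨0, fun _ => X, fun _ => hX, fun i j h => absurd h (by omega),
      rfl, by simp⟩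
  | @step Y X s _ hX hYX ih =>
    obtain ⟨n, Z, hZ, hlt, hlast, rfl⟩ := ih
    refine ⟨n + 1, Fin.snoc (α := fun _ => C) Z X, fun i => ?_, fun i j h => ?_, by simp, ?_⟩
    · cases i using Fin.lastCases with
      | last => simpa using hX
      | cast i => simpa using hZ i
    · cases i using Fin.lastCases with
      | last => exact absurd h (not_lt.2 (Fin.le_last _))
      | cast i =>
        cases j using Fin.lastCases with
        | cast j => simpa using hlt i j (by simpa using h)
        | last =>
          simp only [Fin.snoc_castSucc, Fin.snoc_last]
          rcases (Fin.le_last i).lt_or_eq with hi | rfl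
          · exact hl.strictSubOf_trans (hlast ▸ hlt _ _ hi) hYX
          · exact hlast ▸ hYX
    · ext a
      simp [Fin.exists_fin_succ', or_comm, eq_comm]

end GRChain

lemma isGRMeasure_iff {l : C → ℝ} (hl : IsLengthFunctionCat l) {μ : C → Finset ℝ} :
    IsGRMeasure l μ ↔
      ∀ X, Indec X → GRChain l X (μ X) ∧ ∀ s, GRChain l X s → lexLE s (μ X) := by
  refine forall₂_congr fun X _ => and_congr ⟨?_, fun h => h.exists_fin hl⟩ ⟨?_, ?_⟩
  · rintro ⟨n, Z, hZ, hlt, rfl, h⟩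
    exact h ▸ GRChain.of_fin n Z hZ hlt
  · intro h s hs
    obtain ⟨n, Z, hZ, hlt, hlast, rfl⟩ := hs.exists_fin hl
    exact h n Z hZ hlt hlast
  · rintro h n Z hZ hlt rfl
    exact h _ (GRChain.of_fin n Z hZ hlt)

/-- A retract of an indecomposable object is zero or the whole object. -/
lemma Indec.isIso_of_comp_eq_id {X Y : C} (hX : Indec X) (hY : ¬ IsZero Y) {s : Y ⟶ X} {p : X ⟶ Y}
    (h : s ≫ p = 𝟙 Y) : IsIso s := by
  have : Mono s := mono_of_mono_fac h
  let S := ShortComplex.mk s (cokernel.π s) (cokernel.condition s)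
  have hS : S.ShortExact := (SES.of_mono s).shortExact
  let σ : S.Splitting := ShortComplex.Splitting.ofExactOfRetraction S hS.exact p h inferInstance
  rcases hX.2 _ _ ⟨σ.isoBinaryBiproduct⟩ with h0 | h0
  · exact absurd h0 hY
  · have : Epi s := Preadditive.epi_of_cokernel_zero (h0.eq_of_tgt _ _)
    exact isIso_of_mono_of_epi s

lemma ProperSub.biprod_inl {X A B : C} (e : X ≅ A ⊞ B) (hB : ¬ IsZero B) : ProperSub A X := by
  refine ⟨biprod.inl ≫ e.inv, inferInstance, fun h => hB ?_⟩
  have : IsIso (biprod.inl : A ⟶ A ⊞ B) := IsIso.of_isIso_comp_right _ e.inv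
  exact (Biprod.isIso_inl_iff_isZero A B).1 this

/-- The projections to indecomposable direct summands of an object are jointly monic. -/
lemma eq_zero_of_comp_retractions (hC : IsLengthCategory C) (A : C) :
    ∀ {W : C} (g : W ⟶ A),
      (∀ (Y : C) (s : Y ⟶ A) (p : A ⟶ Y), Indec Y → s ≫ p = 𝟙 Y → g ≫ p = 0) → g = 0 := by
  induction A using (wellFounded_properSub hC).induction with
  | h A ih =>
    intro W g hg
    by_cases hz : IsZero A
    · exact hz.eq_of_tgt _ _
    by_cases hA : Indec A
    · simpa using hg A (𝟙 A) (𝟙 A) hA (by simp)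
    obtain ⟨B, D, ⟨e⟩, hB, hD⟩ : ∃ B D : C, Nonempty (A ≅ B ⊞ D) ∧ ¬ IsZero B ∧ ¬ IsZero D := by
      simp only [Indec, not_and, not_forall, not_or] at hA
      obtain ⟨B, D, e, hB, hD⟩ := hA hz
      exact ⟨B, D, e, hB, hD⟩
    have h1 := ih B (ProperSub.biprod_inl e hD) (g ≫ e.hom ≫ biprod.fst) fun Y s p hY hsp => by
      simpa using hg Y (s ≫ biprod.inl ≫ e.inv) (e.hom ≫ biprod.fst ≫ p) hY (by simp [hsp])
    have h2 := ih D (ProperSub.biprod_inl (e ≪≫ biprod.braiding B D) hB)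
      (g ≫ e.hom ≫ biprod.snd) fun Y s p hY hsp => by
      simpa using hg Y (s ≫ biprod.inr ≫ e.inv) (e.hom ≫ biprod.snd ≫ p) hY (by simp [hsp])
    rw [← cancel_mono e.hom]
    apply biprod.hom_ext <;> simp [h1, h2]

section MainProperty

variable {l : C → ℝ} (hl : IsLengthFunctionCat l) {μ : C → Finset ℝ} (hμ : IsGRMeasure l μ)
include hl hμ

lemma IsGRMeasure.lexLT_of_strictSubOf {X Y : C} (hX : Indec X) (hY : Indec Y)
    (h : StrictSubOf X Y) : lexLT (μ X) (μ Y) := by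
  rw [isGRMeasure_iff hl] at hμ
  have hc := (hμ X hX).1
  exact (lexLT_insert_of_lt (hc.lt hl h)).trans_le ((hμ Y hY).2 _ (hc.step hY h))

lemma IsGRMeasure.eq_of_iso {X Y : C} (hX : Indec X) (e : X ≅ Y) : μ X = μ Y := by
  rw [isGRMeasure_iff hl] at hμ
  have hY := hX.iso e
  exact lexLE_antisymm ((hμ Y hY).2 _ ((hμ X hX).1.iso hl e))
    ((hμ X hX).2 _ ((hμ Y hY).1.iso hl e.symm))

lemma IsGRMeasure.isIso_or_lexLT {X Y : C} (hX : Indec X) (hY : Indec Y) (f : X ⟶ Y) [Mono f] :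
    IsIso f ∨ lexLT (μ X) (μ Y) := by
  by_cases h : IsIso f
  · exact .inl h
  · exact .inr (hμ.lexLT_of_strictSubOf hl hX hY (hl.strictSubOf_of_mono f h))

/-- The Gabriel-Roiter measure of `X` is `{l X}`, or obtained by adding `l X` to the measure of
an indecomposable proper subobject. -/
lemma IsGRMeasure.eq_insert {X : C} (hX : Indec X) :
    μ X = {l X} ∨ ∃ Y, Indec Y ∧ StrictSubOf Y X ∧ μ X = insert (l X) (μ Y) := by
  rw [isGRMeasure_iff hl] at hμ
  generalize hs : μ X = s
  have hc := (hμ X hX).1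
  rw [hs] at hc
  cases hc with
  | base _ => exact .inl rfl
  | @step Y _ s hY _ hYX =>
    refine .inr ⟨Y, hY.indec, hYX, ?_⟩
    have hY' := hμ Y hY.indec
    refine lexLE_antisymm (lexLE_insert_insert (hY'.2 _ hY) (hY'.1.lt hl hYX)) ?_
    exact hs ▸ (hμ X hX).2 _ (hY'.1.step hX hYX)

lemma IsGRMeasure.lt_of_lt {X Y : C} (hY : Indec Y) (h : l Y < l X) : ∀ a ∈ μ Y, a < l X := by
  rw [isGRMeasure_iff hl] at hμ
  exact fun a ha => ((hμ Y hY).1.le hl a ha).trans_lt h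

/-- The main property of Gabriel: for a jointly monic family of maps from an indecomposable object `X`
to indecomposable objects, either one of them is an isomorphism, or one of the targets has
Gabriel-Roiter measure strictly larger than `X`. -/
lemma IsGRMeasure.main_property (hC : IsLengthCategory C) (n : ℕ) :
    ∀ X : C, (μ X).card ≤ n → Indec X → ∀ F : ∀ Y : C, (X ⟶ Y) → Prop,
      (∀ Y f, F Y f → Indec Y) →
      (∀ {W : C} (g : W ⟶ X), (∀ Y f, F Y f → g ≫ f = 0) → g = 0) →
      ∃ Y f, F Y f ∧ (IsIso f ∨ lexLT (μ X) (μ Y)) := by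
  induction n with
  | zero =>
    intro X hcard hX
    have := ((isGRMeasure_iff hl).1 hμ X hX).1.mem
    rw [Finset.card_eq_zero.1 (Nat.le_zero.1 hcard)] at this
    simp at this
  | succ n ih =>
    intro X hcard hX F hF hmono
    by_cases hm : ∃ Y f, F Y f ∧ Mono f
    · obtain ⟨Y, f, hf, _⟩ := hm
      exact ⟨Y, f, hf, hμ.isIso_or_lexLT hl hX (hF Y f hf) f⟩
    push Not at hm
    have hsmall : ∀ {Y Z : C} (f : X ⟶ Y) (s : Z ⟶ image f) (p : image f ⟶ Z), F Y f → Indec Z →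
        s ≫ p = 𝟙 Z → l Z < l X ∧ lexLE (μ Z) (μ Y) := by
      intro Y Z f s p hf hZ hsp
      have : Mono s := mono_of_mono_fac hsp
      constructor
      · refine (hl.le_of_mono s).trans_lt (lt_of_not_ge fun hle => hm Y f hf ?_)
        have : IsIso (factorThruImage f) := hl.isIso_of_epi _ hle
        rw [← image.fac f]
        infer_instance
      · rcases hμ.isIso_or_lexLT hl hZ (hF Y f hf) (s ≫ image.ι f) with h | h
        · rw [hμ.eq_of_iso hl hZ (asIso (s ≫ image.ι f))]
          exact lexLE_refl _
        · exact h.1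
    rcases hμ.eq_insert hl hX with hμX | ⟨X', hX', hlt, hμX⟩
    · obtain ⟨Y, f, hf, Z, s, p, hZ, hsp⟩ : ∃ Y, ∃ f : X ⟶ Y, F Y f ∧
          ∃ (Z : C) (s : Z ⟶ image f) (p : image f ⟶ Z), Indec Z ∧ s ≫ p = 𝟙 Z := by
        by_contra hcon
        push Not at hcon
        refine hX.1 ((IsZero.iff_id_eq_zero X).2 (hmono (𝟙 X) fun Y f hf => ?_))
        have : factorThruImage f = 0 := eq_zero_of_comp_retractions hC _ _
          fun Z s p hZ hsp => absurd hsp (hcon Y f hf Z s p hZ)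
        rw [← image.fac f, this]; simp
      obtain ⟨h1, h2⟩ := hsmall f s p hf hZ hsp
      refine ⟨Y, f, hf, .inr (lexLT.trans_le ?_ h2)⟩
      have hne : (μ Z).Nonempty := ⟨_, ((isGRMeasure_iff hl).1 hμ Z hZ).1.mem⟩
      rw [hμX]
      simpa using (lexLT_empty hne).insert_left (hμ.lt_of_lt hl hZ h1)
    · obtain ⟨⟨i, hi⟩, hlX⟩ := hl.strictSubOf_iff.1 hlt
      have hlt' := ((isGRMeasure_iff hl).1 hμ X' hX').1.lt hl hlt
      have hcard' : (μ X').card ≤ n := by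
        rw [hμX, Finset.card_insert_of_notMem fun h => lt_irrefl _ (hlt' _ h)] at hcard
        omega
      obtain ⟨Z, k, ⟨Y, f, hf, s, p, hZ, hsp, rfl⟩, hk⟩ := ih X' hcard' hX'
        (fun Z k => ∃ Y, ∃ f : X ⟶ Y, F Y f ∧ ∃ (s : Z ⟶ image f) (p : image f ⟶ Z), Indec Z ∧
          s ≫ p = 𝟙 Z ∧ k = i ≫ factorThruImage f ≫ p)
        (by rintro Z k ⟨_, _, _, _, _, hZ, -⟩; exact hZ)
        (by
          intro W g hg
          rw [← cancel_mono i, zero_comp]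
          refine hmono _ fun Y f hf => ?_
          have : (g ≫ i) ≫ factorThruImage f = 0 := eq_zero_of_comp_retractions hC _ _
            fun Z s p hZ hsp => by
              simpa using hg Z _ ⟨Y, f, hf, s, p, hZ, hsp, rfl⟩
          rw [← image.fac f, ← Category.assoc, this, zero_comp])
      obtain ⟨h1, h2⟩ := hsmall f s p hf hZ hsp
      rcases hk with hk | hk
      · have hii := hX.isIso_of_comp_eq_id hX'.1
          (s := i) (p := (factorThruImage f ≫ p) ≫ inv (i ≫ factorThruImage f ≫ p))
          (by rw [← Category.assoc, IsIso.hom_inv_id])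
        exact absurd (hl.eq_of_iso (asIso i)) hlX.ne
      · refine ⟨Y, f, hf, .inr (lexLT.trans_le ?_ h2)⟩
        rw [hμX]
        exact hk.insert_left (hμ.lt_of_lt hl hZ h1)

end MainProperty

lemma injective_of_splits {Q : C} (h : ∀ (Y : C) (f : Q ⟶ Y), Mono f → ∃ r, f ≫ r = 𝟙 Q) :
    Injective Q where
  factors {A B} g m hm := by
    obtain ⟨r, hr⟩ := h _ (pushout.inr m g) inferInstance
    exact ⟨pushout.inl m g ≫ r, by rw [← Category.assoc, pushout.condition, Category.assoc, hr,
      Category.comp_id]⟩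

lemma injective_of_gr_maximal (hC : IsLengthCategory C) {Q : C} (hQ : Indec Q) {l : C → ℝ}
    (hl : IsLengthFunctionCat l) {μ : C → Finset ℝ} (hμ : IsGRMeasure l μ)
    (hmax : ∀ X : C, Indec X → lexLE (μ X) (μ Q)) : Injective Q := by
  refine injective_of_splits fun Y f hf => ?_
  obtain ⟨Z, k, ⟨s, p, hZ, hsp, rfl⟩, hk⟩ := hμ.main_property hl hC _ Q le_rfl hQ
    (fun Z k => ∃ (s : Z ⟶ Y) (p : Y ⟶ Z), Indec Z ∧ s ≫ p = 𝟙 Z ∧ k = f ≫ p)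
    (by rintro Z k ⟨_, _, hZ, -⟩; exact hZ)
    (by
      intro W g hg
      rw [← cancel_mono f, zero_comp]
      exact eq_zero_of_comp_retractions hC _ _ fun Z s p hZ hsp => by
        simpa using hg Z _ ⟨s, p, hZ, hsp, rfl⟩)
  rcases hk with hk | hk
  · exact ⟨p ≫ inv (f ≫ p), by rw [← Category.assoc, IsIso.hom_inv_id]⟩
  · exact absurd (hmax Z hZ) hk.2

/-- The Fitting lemma: an endomorphism of an indecomposable object of finite length is a
monomorphism or nilpotent. -/
lemma Indec.mono_or_pow_eq_zero {N : C → ℕ} (hN : IsLengthFunctionCat fun X : C => (N X : ℝ))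
    {Q : C} (hQ : Indec Q) (g : End Q) : Mono (C := C) (X := Q) (Y := Q) g ∨ ∃ n : ℕ, g ^ n = 0 := by
  classical
  have hex : ∃ m, ∃ (n : ℕ) (I : C) (a : Q ⟶ I) (b : I ⟶ Q), Epi a ∧ Mono b ∧
      g ^ (n + 1) = a ≫ b ∧ m = N I :=
    ⟨_, 0, image (C := C) (X := Q) (Y := Q) g, factorThruImage _, image.ι _, inferInstance,
      inferInstance, by simp, rfl⟩
  obtain ⟨n, I, a, b, ha, hb, hab, hI⟩ := Nat.find_spec hex
  let u : I ⟶ I := b ≫ a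
  have hmin : N I ≤ N (image u) := by
    rw [← hI]
    refine Nat.find_min' hex ⟨n + 1 + n, image u, a ≫ factorThruImage u, image.ι u ≫ b,
      inferInstance, inferInstance, ?_, rfl⟩
    rw [add_assoc, pow_add, End.mul_def, hab, Category.assoc, Category.assoc,
      image.fac_assoc]
    simp [u]
  have h1 : IsIso (factorThruImage u) := hN.isIso_of_epi _ (by exact_mod_cast hmin)
  have h2 : IsIso (image.ι u) := hN.isIso_of_mono _ (by exact_mod_cast hmin)
  have hu : IsIso u := by rw [← image.fac u]; infer_instance
  by_cases hz : IsZero I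
  · exact .inr ⟨n + 1, by rw [hab, hz.eq_of_tgt a 0, zero_comp]⟩
  · left
    have hb' : IsIso b := hQ.isIso_of_comp_eq_id hz (s := b) (p := a ≫ inv u)
      (by rw [← Category.assoc, IsIso.hom_inv_id])
    have ha' : IsIso a := IsIso.of_isIso_comp_left b a
    have : Mono (a ≫ b) := inferInstance
    rw [← hab, pow_succ, End.mul_def] at this
    exact mono_of_mono (C := C) (X := Q) (Y := Q) (Z := Q) g (g ^ n : End Q)

section InjectiveIndecomposable

variable {N : C → ℕ} (hN : IsLengthFunctionCat fun X : C => (N X : ℝ)) {Q : C} (hQ : Indec Q)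
  [Injective Q]
include hN hQ

/-- An indecomposable injective object of finite length is uniform. -/
lemma isZero_or_isZero_of_mono_biprod_desc {A B : C} (a : A ⟶ Q) (b : B ⟶ Q)
    [Mono (biprod.desc a b)] : IsZero A ∨ IsZero B := by
  let g : Q ⟶ Q := Injective.factorThru (biprod.desc a (0 : B ⟶ Q)) (biprod.desc a b)
  have hg : biprod.desc a b ≫ g = biprod.desc a 0 := Injective.comp_factorThru _ _
  have hag : a ≫ g = a := by simpa using congrArg (biprod.inl ≫ ·) hg
  have hbg : b ≫ g = 0 := by simpa using congrArg (biprod.inr ≫ ·) hg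
  have hma : Mono a := by
    have : a = biprod.inl ≫ biprod.desc a b := by simp
    rw [this]; infer_instance
  have hmb : Mono b := by
    have : b = biprod.inr ≫ biprod.desc a b := by simp
    rw [this]; infer_instance
  rcases hQ.mono_or_pow_eq_zero hN (End.of g) with h | ⟨n, hn⟩
  · exact .inr (IsZero.of_mono_eq_zero b ((cancel_mono g).1 (by rw [hbg, zero_comp])))
  · left
    have key : ∀ m : ℕ, a ≫ (End.of g ^ m : End Q) = a := by
      intro m
      induction m with
      | zero => exact Category.comp_id a
      | succ m ih => rw [pow_succ, End.mul_def, ← Category.assoc]; exact (congrArg (· ≫ _) hag).trans ih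
    refine IsZero.of_mono_eq_zero a ?_
    rw [← key n, hn]
    exact comp_zero

lemma indec_of_mono_injective {B : C} (f : B ⟶ Q) [Mono f] (hB : ¬ IsZero B) : Indec B := by
  refine ⟨hB, fun A D ⟨e⟩ => ?_⟩
  have h : biprod.desc (biprod.inl ≫ e.inv ≫ f) (biprod.inr ≫ e.inv ≫ f) = e.inv ≫ f := by
    apply biprod.hom_ext' <;> simp
  have : Mono (biprod.desc (biprod.inl ≫ e.inv ≫ f) (biprod.inr ≫ e.inv ≫ f)) := by
    rw [h]; infer_instance
  exact isZero_or_isZero_of_mono_biprod_desc hN hQ (biprod.inl ≫ e.inv ≫ f) (biprod.inr ≫ e.inv ≫ f)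

/-- If the socle of the injective `Q` has the strictly smallest length, every chain of
indecomposables ending outside of `Q` is dominated by a chain ending at `Q`. -/
lemma GRChain.exists_lexLT_or_subOf {S : C} (hS : ¬ IsZero S) (j : S ⟶ Q) [Mono j]
    (hmin : ∀ X : C, ¬ IsZero X → N X ≤ N S → Nonempty (X ≅ S)) {X : C} {s : Finset ℝ}
    (h : GRChain (fun X : C => (N X : ℝ)) X s) :
    (∃ t, GRChain (fun X : C => (N X : ℝ)) Q t ∧ ∃ b ∈ t, b ∉ s ∧ b < N X ∧
      ∀ a < b, (a ∈ s ↔ a ∈ t)) ∨ SubOf X Q := by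
  have extend : ∀ {Y : C} {s : Finset ℝ}, GRChain (fun X : C => (N X : ℝ)) Y s → SubOf Y Q →
      ∃ t, GRChain (fun X : C => (N X : ℝ)) Q t ∧ s ⊆ t ∧ ∀ a < (N Y : ℝ), (a ∈ s ↔ a ∈ t) := by
    rintro Y s hY ⟨f, hf⟩
    by_cases hi : IsIso f
    · exact ⟨s, hY.iso hN (asIso f), subset_rfl, fun a _ => Iff.rfl⟩
    · have hYQ := hN.strictSubOf_of_mono f hi
      refine ⟨_, hY.step hQ hYQ, Finset.subset_insert _ _, fun a ha => ?_⟩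
      have := (hN.strictSubOf_iff.1 hYQ).2
      simp [(ha.trans this).ne]
  induction h with
  | @base X hX =>
    by_cases hXQ : SubOf X Q
    · exact .inr hXQ
    left
    have hlt : N S < N X := by
      by_contra hle
      obtain ⟨e⟩ := hmin X hX.1 (not_lt.1 hle)
      exact hXQ ⟨e.hom ≫ j, inferInstance⟩
    obtain ⟨t, ht, hst, htS⟩ := extend (.base (indec_of_mono_injective hN hQ j hS)) ⟨j, inferInstance⟩
    have hlt' : (N S : ℝ) < N X := by exact_mod_cast hlt
    refine ⟨t, ht, N S, hst (by simp), by simp [hlt.ne], hlt', fun a ha => ?_⟩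
    rw [← htS a ha]
    simp [ha.ne, (ha.trans hlt').ne]
  | @step Y X s hY hX hYX ih =>
    have hYX' := (hN.strictSubOf_iff.1 hYX).2
    rcases ih with ⟨t, ht, b, hbt, hbs, hbY, hb⟩ | ⟨φ, hφ⟩
    · have hbX := hbY.trans hYX'
      refine .inl ⟨t, ht, b, hbt, by simp [hbs, hbX.ne], hbX, fun a ha => ?_⟩
      rw [← hb a ha]
      simp [(ha.trans hbX).ne]
    obtain ⟨i, hi⟩ := hYX.1
    let ψ : X ⟶ Q := Injective.factorThru φ i
    have hψ : i ≫ ψ = φ := Injective.comp_factorThru φ i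
    by_cases hm : Mono ψ
    · exact .inr ⟨ψ, hm⟩
    left
    have hYI : Mono (i ≫ factorThruImage ψ) := by
      have : Mono ((i ≫ factorThruImage ψ) ≫ image.ι ψ) := by
        rwa [Category.assoc, image.fac, hψ]
      exact mono_of_mono _ (image.ι ψ)
    have hIX : (N (image ψ) : ℝ) < N X := by
      refine lt_of_not_ge fun hle => hm ?_
      have : IsIso (factorThruImage ψ) := hN.isIso_of_epi _ hle
      rw [← image.fac ψ]
      infer_instance
    have hI : Indec (image ψ) := indec_of_mono_injective hN hQ (image.ι ψ)
      fun hz => hY.indec.1 (IsZero.of_mono (i ≫ factorThruImage ψ) hz)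
    have hYI' : StrictSubOf Y (image ψ) := hN.strictSubOf_of_mono (i ≫ factorThruImage ψ)
      fun hiso => by
        have := hX.isIso_of_comp_eq_id hY.indec.1
          (s := i) (p := factorThruImage ψ ≫ inv (i ≫ factorThruImage ψ))
          (by rw [← Category.assoc, IsIso.hom_inv_id])
        exact absurd (hN.eq_of_iso (asIso i)) hYX'.ne
    have hlt := hY.lt hN hYI'
    obtain ⟨t, ht, hst, htI⟩ := extend (hY.step hI hYI') ⟨image.ι ψ, inferInstance⟩
    refine ⟨t, ht, N (image ψ), hst (by simp), ?_, hIX, fun a ha => ?_⟩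
    · simp only [Finset.mem_insert, not_or]
      exact ⟨hIX.ne, fun hmem => lt_irrefl _ (hlt _ hmem)⟩
    · rw [← htI a ha]
      simp [ha.ne, (ha.trans hIX).ne]

lemma GRChain.exists_lexLE_of_injective {S : C} (hS : ¬ IsZero S) (j : S ⟶ Q) [Mono j]
    (hmin : ∀ X : C, ¬ IsZero X → N X ≤ N S → Nonempty (X ≅ S)) {X : C} {s : Finset ℝ}
    (h : GRChain (fun X : C => (N X : ℝ)) X s) :
    ∃ t, GRChain (fun X : C => (N X : ℝ)) Q t ∧ lexLE s t := by
  rcases h.exists_lexLT_or_subOf hN hQ hS j hmin with ⟨t, ht, b, hbt, hbs, -, hb⟩ | ⟨f, hf⟩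
  · exact ⟨t, ht, lexLE_iff.2 (.inr ⟨b, hbt, hbs, hb⟩)⟩
  · by_cases hi : IsIso f
    · exact ⟨s, h.iso hN (asIso f), lexLE_refl s⟩
    · have hXQ := hN.strictSubOf_of_mono f hi
      exact ⟨_, h.step hQ hXQ, (lexLT_insert_of_lt (h.lt hN hXQ)).1⟩

end InjectiveIndecomposable

/-- An integral length function admits a Gabriel-Roiter measure. -/
lemma exists_isGRMeasure {N : C → ℕ} (hN : IsLengthFunctionCat fun X : C => (N X : ℝ)) :
    ∃ μ, IsGRMeasure (fun X : C => (N X : ℝ)) μ := by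
  have key : ∀ X : C, ∃ s, Indec X → GRChain (fun X : C => (N X : ℝ)) X s ∧
      ∀ t, GRChain (fun X : C => (N X : ℝ)) X t → lexLE t s := by
    intro X
    by_cases hX : Indec X
    · have hfin : {s | GRChain (fun X : C => (N X : ℝ)) X s}.Finite := by
        refine ((Finset.range (N X + 1)).image (Nat.cast : ℕ → ℝ)).powerset.finite_toSet.subset ?_
        intro s hs
        simp only [Finset.mem_coe, Finset.mem_powerset]
        have hle := GRChain.le hN hs
        intro a ha
        have hnat : ∃ n : ℕ, (n : ℝ) = a := by
          clear hle
          have hs' : GRChain (fun X : C => (N X : ℝ)) X s := hs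
          induction hs' with
          | @base X => exact ⟨N X, (Finset.mem_singleton.1 ha).symm⟩
          | @step Y X s hY _ _ ih =>
            rcases Finset.mem_insert.1 ha with rfl | ha
            exacts [⟨_, rfl⟩, ih hY.indec hY ha]
        obtain ⟨n, rfl⟩ := hnat
        have : n ≤ N X := by exact_mod_cast hle _ ha
        exact Finset.mem_image_of_mem _ (Finset.mem_range.2 (by omega))
      obtain ⟨s, hs, h⟩ := exists_lexLE_max hfin ⟨_, GRChain.base hX⟩
      exact ⟨s, fun _ => ⟨hs, h⟩⟩
    · exact ⟨∅, fun h => absurd h hX⟩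
  choose μ hμ using key
  exact ⟨μ, (isGRMeasure_iff hN).2 hμ⟩

open scoped Classical in
/-- The weight giving `S` weight one and all the other simple objects weight two. -/
noncomputable def socleWeight {D : Type u} [Category.{v} D] (S T : D) : ℕ :=
  if Nonempty (T ≅ S) then 1 else 2

lemma socleWeight_pos {D : Type u} [Category.{v} D] (S T : D) : 0 < socleWeight S T := by
  unfold socleWeight; split_ifs <;> simp

lemma socleWeight_iso {D : Type u} [Category.{v} D] (S T T' : D) : Nonempty (T ≅ T') →
    socleWeight S T = socleWeight S T' := by
  rintro ⟨e⟩
  have : Nonempty (T ≅ S) ↔ Nonempty (T' ≅ S) :=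
    ⟨fun ⟨f⟩ => ⟨e.symm ≪≫ f⟩, fun ⟨f⟩ => ⟨e ≪≫ f⟩⟩
  simp only [socleWeight]
  split_ifs <;> tauto

lemma HasLen.of_simple (w : C → ℕ) {S : C} (hS : Simple S) : HasLen w S (w S) := by
  have hz : IsZero (kernel (𝟙 S)) :=
    IsZero.of_mono_eq_zero (kernel.ι (𝟙 S)) (by simpa using kernel.condition (𝟙 S))
  simpa using HasLen.step (SES.of_epi (𝟙 S)) hS (.zero hz : HasLen w _ 0)

lemma HasLen.nonempty_iso_of_le_one {S X : C} {r : ℕ} (h : HasLen (socleWeight S) X r)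
    (hr : r ≤ 1) (hX : ¬ IsZero X) : Nonempty (X ≅ S) := by
  cases h with
  | zero h => exact absurd h hX
  | @step A _ T f g r h hT hA =>
    have hpos := socleWeight_pos S T
    have hT1 : socleWeight S T = 1 := by omega
    have hr0 : r = 0 := by omega
    have hz : IsZero A := by
      cases hA with
      | zero h => exact h
      | @step _ _ T' => have := socleWeight_pos S T'; omega
    have := h.epi
    have : Mono g := Preadditive.mono_of_cancel_zero g fun k hk => by
      obtain ⟨l, rfl⟩ := h.lift k hk
      rw [hz.eq_of_tgt l 0, zero_comp]
    have : IsIso g := isIso_of_mono_of_epi g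
    have hTS : Nonempty (T ≅ S) := by
      by_contra hn
      simp [socleWeight, hn] at hT1
    exact hTS.map fun e => asIso g ≪≫ e

lemma exists_gr_maximal_of_injective (hC : IsLengthCategory C) {Q : C} (hQ : Indec Q)
    [Injective Q] : ∃ (l : C → ℝ) (μ : C → Finset ℝ), IsLengthFunctionCat l ∧ IsGRMeasure l μ ∧
      ∀ X : C, Indec X → lexLE (μ X) (μ Q) := by
  have : IsArtinianObject Q := ⟨(hC Q).1⟩
  obtain ⟨S, hS⟩ := exists_simple_subobject hQ.1
  set N : C → ℕ := weightLen hC (socleWeight (S : C))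
  have hN : IsLengthFunctionCat fun X : C => (N X : ℝ) :=
    isLengthFunctionCat_weightLen hC (socleWeight_iso _) (socleWeight_pos _)
  obtain ⟨μ, hμ⟩ := exists_isGRMeasure hN
  refine ⟨_, μ, hN, hμ, fun X hX => ?_⟩
  rw [isGRMeasure_iff hN] at hμ
  have hNS : N (S : C) = 1 := by
    refine (HasLen.unique hC (socleWeight_iso _) _ (hasLen_weightLen hC _ _) (.of_simple _ hS)).trans ?_
    simp [socleWeight, show Nonempty ((S : C) ≅ S) from ⟨Iso.refl _⟩]
  obtain ⟨t, ht, hXt⟩ := (hμ X hX).1.exists_lexLE_of_injective hN hQ (Simple.not_isZero (S : C))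
    S.arrow fun Y hY hle => (hasLen_weightLen hC _ Y).nonempty_iso_of_le_one (hle.trans hNS.le) hY
  exact lexLE_trans hXt ((hμ Q hQ).2 t ht)

/-- An indecomposable object `Q` is injective iff there is a length function `ℓ` such
that the Gabriel-Roiter measure `ℓ*` attains its maximal value at `Q`, i.e.
`ℓ*(X) ≤ ℓ*(Q)` for every indecomposable `X`. -/
theorem injective_iff_gr_maximal {C : Type u} [Category.{v} C] [Abelian C]
    (hC : IsLengthCategory C) (Q : C) (hQ : Indec Q) :
    Injective Q ↔
      ∃ (l : C → ℝ) (μ : C → Finset ℝ), IsLengthFunctionCat l ∧ IsGRMeasure l μ ∧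
        ∀ X : C, Indec X → lexLE (μ X) (μ Q) := by
  constructor
  · intro h
    exact exists_gr_maximal_of_injective hC hQ
  · rintro ⟨l, μ, hl, hμ, hmax⟩
    exact injective_of_gr_maximal hC hQ hl hμ hmax
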